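/- arXiv:1210.6954 — 3 statements merged into one kernel-verified Lean document; each statement's English description precedes it below -/
import Mathlib

section
/- Let r ≥ 1, δ ≥ 2, α ≥ 1 and n be integers with r + δ − 1 < n and (r + δ − 1) | n; let q be a prime power with q ≥ r + δ − 1; set N = n·r·α/(r + δ − 1); let m ≥ N be an integer and let K be a finite field with |K| = q^m. Then for every integer 𝓜 with r·α ≤ 𝓜 ≤ N there exists a code C of length n over the alphabet K^α with |C| = (q^m)^𝓜 that has (r, δ) locality and whose minimum distance equals n − ⌈𝓜/α⌉ + 1 − (⌈𝓜/(r·α)⌉ − 1)·(δ − 1); that is, C attains the minimum-distance upper bound for (r, δ, α) locally repairable codes. -/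
/-! Framework for (vector) codes of length `n` over an alphabet `A`:
codewords are functions `Fin n → A`, `puncture` restricts codewords to a subset of
coordinates, `minDist` is the minimum Hamming distance between distinct codewords, and
`HasLocality C r δ` is the `(r, δ)` locality property. -/

/-- The punctured code `C|_S`: restrictions of the codewords of `C` to `S`. -/
def puncture {n : ℕ} {A : Type*} (C : Set (Fin n → A)) (S : Finset (Fin n)) :
    Set (↥S → A) :=
  (fun c => fun i : ↥S => c i) '' C

/-- Minimum (Hamming) distance of a code: the least Hamming distance between two
distinct codewords. -/
noncomputable def minDist {n : ℕ} {A : Type*} [DecidableEq A] (C : Set (Fin n → A)) : ℕ :=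
  sInf {d | ∃ c ∈ C, ∃ c' ∈ C, c ≠ c' ∧ hammingDist c c' = d}

/-- `C` has `(r, δ)` locality: every coordinate `i` lies in a set `Γ` of at most
`r + δ - 1` coordinates such that the punctured code `C|_Γ` has minimum distance at
least `δ` (i.e. any two distinct restricted codewords are at Hamming distance ≥ δ). -/
def HasLocality {n : ℕ} {A : Type*} [DecidableEq A] (C : Set (Fin n → A)) (r δ : ℕ) :
    Prop :=
  ∀ i : Fin n, ∃ Γ : Finset (Fin n), i ∈ Γ ∧ Γ.card ≤ r + δ - 1 ∧
    ∀ u ∈ puncture C Γ, ∀ v ∈ puncture C Γ, u ≠ v → δ ≤ hammingDist u v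

/-- A subfield of order `q` inside a field of order `q ^ m`, in the form of an algebra structure. -/
theorem exists_field_algebra_of_card_eq_pow {K : Type} [Field K] [Fintype K] {q m : ℕ}
    (hq : IsPrimePow q) (hm : m ≠ 0) (hK : Fintype.card K = q ^ m) :
    ∃ (F : Type) (_ : Field F) (_ : Fintype F) (_ : Algebra F K), Fintype.card F = q := by
  obtain ⟨p, k, hp, hk, rfl⟩ := hq
  have hp' : p.Prime := hp.nat_prime
  have : Fact p.Prime := ⟨hp'⟩
  obtain ⟨p', _, l, hp'', hl⟩ := FiniteField.card' K
  have hpp : p = p' := by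
    have h1 : p ∣ p' ^ (l : ℕ) := by
      rw [← hl, hK, ← pow_mul]
      exact dvd_pow_self p (mul_ne_zero hk.ne' hm)
    exact (Nat.prime_dvd_prime_iff_eq hp' hp'').1 (hp'.dvd_of_dvd_pow h1)
  subst hpp
  let : Algebra (ZMod p) K := ZMod.algebra K p
  have hfr : Module.finrank (ZMod p) K = k * m := by
    have h := Module.card_eq_pow_finrank (K := ZMod p) (V := K)
    rw [hK, ZMod.card, ← pow_mul] at h
    exact (Nat.pow_right_injective hp'.two_le h).symm
  have hdvd : Module.finrank (ZMod p) (GaloisField p k) ∣ Module.finrank (ZMod p) K := by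
    rw [hfr, GaloisField.finrank p hk.ne']
    exact dvd_mul_right _ _
  obtain ⟨φ⟩ := FiniteField.nonempty_algHom_of_finrank_dvd hdvd
  let : Fintype (GaloisField p k) := Fintype.ofFinite _
  refine ⟨GaloisField p k, inferInstance, inferInstance, φ.toRingHom.toAlgebra, ?_⟩
  rw [← Nat.card_eq_fintype_card, GaloisField.card p k hk.ne']

section LinearizedPolynomials

variable {F K : Type*} [Field F] [Fintype F] [Field K] [Algebra F K]

/-- The `F`-linear map `x ↦ ∑ i, c i * x ^ (q ^ i)`, `q = |F|`, depending linearly on `c`. -/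
noncomputable def linearizedEval (F K : Type*) [Field F] [Fintype F] [Field K] [Algebra F K]
    (M : ℕ) : (Fin M → K) →ₗ[K] (K →ₗ[F] K) :=
  Fintype.linearCombination K fun i : Fin M =>
    ((FiniteField.frobeniusAlgHom F K) ^ (i : ℕ)).toLinearMap

theorem linearizedEval_apply {M : ℕ} (c : Fin M → K) (x : K) :
    linearizedEval F K M c x = ∑ i, c i * x ^ Fintype.card F ^ (i : ℕ) := by
  simp [linearizedEval, Fintype.linearCombination_apply, AlgHom.coe_pow,
    FiniteField.coe_frobeniusAlgHom, pow_iterate]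

open Polynomial in
/-- A nonzero linearized polynomial of `q`-degree less than `M` vanishes on fewer than `M`
linearly independent points. -/
theorem card_lt_of_linearizedEval_eq_zero [Fintype K] {M : ℕ} {c : Fin M → K} (hc : c ≠ 0)
    {ι : Type*} [Fintype ι] {v : ι → K} (hv : LinearIndependent F v)
    (h : ∀ i, linearizedEval F K M c (v i) = 0) : Fintype.card ι < M := by
  classical
  have hq : 1 < Fintype.card F := Fintype.one_lt_card
  obtain ⟨i₀, hi₀⟩ := Function.ne_iff.1 hc
  let P : K[X] := ∑ i : Fin M, C (c i) * X ^ Fintype.card F ^ (i : ℕ)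
  have hPne : P ≠ 0 := by
    intro hP
    apply hi₀
    have := congrArg (fun p => coeff p (Fintype.card F ^ (i₀ : ℕ))) hP
    simp only [P, finsetSum_coeff, coeff_C_mul, coeff_X_pow, coeff_zero,
      (Nat.pow_right_injective hq).eq_iff, Fin.val_inj] at this
    simpa using this
  have hdeg : P.natDegree ≤ Fintype.card F ^ (M - 1) := by
    refine natDegree_sum_le_of_forall_le _ _ fun i _ => ?_
    refine (natDegree_C_mul_X_pow_le _ _).trans (Nat.pow_le_pow_right hq.le ?_)
    omega
  have hroot : ∀ x ∈ Submodule.span F (Set.range v), x ∈ P.roots.toFinset := by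
    intro x hx
    have hle : Submodule.span F (Set.range v) ≤ LinearMap.ker (linearizedEval F K M c) := by
      rw [Submodule.span_le]
      rintro _ ⟨i, rfl⟩
      exact h i
    have h0 : linearizedEval F K M c x = 0 := hle hx
    rw [linearizedEval_apply] at h0
    simpa [hPne, P, eval_finsetSum] using h0
  have hcard : Fintype.card F ^ Fintype.card ι ≤ Fintype.card F ^ (M - 1) := by
    rw [← finrank_span_eq_card hv, ← Module.card_eq_pow_finrank (K := F),
      ← Nat.card_eq_fintype_card]
    calc Nat.card (Submodule.span F (Set.range v))
        ≤ Nat.card P.roots.toFinset :=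
          Nat.card_le_card_of_injective (fun x => ⟨x.1, hroot x.1 x.2⟩)
            fun x y hxy => Subtype.ext (by simpa using hxy)
      _ = P.roots.toFinset.card := Nat.card_eq_card_toFinset _ |>.trans (by rw [Finset.toFinset_coe])
      _ ≤ P.roots.card := Multiset.toFinset_card_le _
      _ ≤ _ := P.card_roots'.trans hdeg
  have := (Nat.pow_le_pow_iff_right hq).1 hcard
  have := i₀.pos
  omega

end LinearizedPolynomials

/-- A polynomial of degree less than `r` with `r` roots is zero. -/
theorem eq_zero_of_sum_pow_mul_eq_zero {R τ : Type*} [CommRing R] [IsDomain R] {r : ℕ}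
    {x : τ → R} (hx : Function.Injective x) {T : Finset τ} (hT : r ≤ T.card) {u : Fin r → R}
    (hu : ∀ t ∈ T, ∑ s : Fin r, x t ^ (s : ℕ) * u s = 0) : u = 0 := by
  obtain ⟨f⟩ : Nonempty (Fin r ↪ T) :=
    Function.Embedding.nonempty_of_card_le (by simpa using hT)
  exact Matrix.eq_zero_of_forall_index_sum_pow_mul_eq_zero
    (f := fun i => x (f i)) (hx.comp (Subtype.val_injective.comp f.injective))
    fun j => hu _ (f j).2

/-- At most `r` moment vectors `(1, x, …, x ^ (r - 1))` are linearly independent. -/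
theorem eq_zero_of_sum_mul_pow_eq_zero {R τ : Type*} [CommRing R] [IsDomain R] {r : ℕ}
    {x : τ → R} (hx : Function.Injective x) {T : Finset τ} (hT : T.card ≤ r) {d : T → R}
    (hd : ∀ s : Fin r, ∑ t : T, d t * x t ^ (s : ℕ) = 0) : d = 0 := by
  let e : Fin T.card ≃ T := T.equivFin.symm
  have key : (fun i => d (e i)) = 0 :=
    Matrix.eq_zero_of_forall_pow_sum_mul_pow_eq_zero
      (f := fun i => x (e i)) (hx.comp (Subtype.val_injective.comp e.injective)) fun i => by
        rw [← hd ⟨i, i.2.trans_le hT⟩]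
        exact e.sum_comp fun t => d t * x t ^ (i : ℕ)
  funext t
  simpa using congrFun key (e.symm t)

section EvaluationPoints

variable {F K J τ : Type*} [Field F] [Field K] [Algebra F K] {r : ℕ}

/-- The points obtained by encoding each block `y (j, ·)` with a Reed–Solomon code. -/
def encodedPoint (x : τ → F) (y : J × Fin r → K) (j : J) (t : τ) : K :=
  ∑ s : Fin r, x t ^ (s : ℕ) • y (j, s)

theorem linearIndependent_encodedPoint [Fintype J] {x : τ → F} (hx : Function.Injective x)
    {y : J × Fin r → K} (hy : LinearIndependent F y) (T : J → Finset τ)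
    (hT : ∀ j, (T j).card ≤ r) :
    LinearIndependent F fun p : Σ j, T j => encodedPoint x y p.1 p.2 := by
  rw [Fintype.linearIndependent_iff] at hy ⊢
  intro d hd
  have h := hy (fun p => ∑ t : T p.1, d ⟨p.1, t⟩ * x t ^ (p.2 : ℕ)) (by
    rw [← hd, Fintype.sum_prod_type, Fintype.sum_sigma]
    refine Finset.sum_congr rfl fun j _ => ?_
    simp only [encodedPoint, Finset.smul_sum, Finset.sum_smul, smul_smul]
    rw [Finset.sum_comm])
  rintro ⟨j, t⟩
  exact congrFun (eq_zero_of_sum_mul_pow_eq_zero hx (hT j) (d := fun t => d ⟨j, t⟩)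
    fun s => h (j, s)) t

/-- If an `F`-linear map vanishes at `r` encoded points of a block, it vanishes at all of them. -/
theorem map_encodedPoint_eq_zero {x : τ → F} (hx : Function.Injective x) (y : J × Fin r → K)
    (f : K →ₗ[F] K) (j : J) {T : Finset τ} (hT : r ≤ T.card)
    (h : ∀ t ∈ T, f (encodedPoint x y j t) = 0) (t : τ) : f (encodedPoint x y j t) = 0 := by
  have hf : ∀ t, f (encodedPoint x y j t) =
      ∑ s : Fin r, algebraMap F K (x t) ^ (s : ℕ) * f (y (j, s)) := fun t => by
    simp only [encodedPoint, map_sum, map_smul]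
    simp only [Algebra.smul_def, map_pow]
  have hu := eq_zero_of_sum_pow_mul_eq_zero (x := fun t => algebraMap F K (x t))
    ((algebraMap F K).injective.comp hx) hT (u := fun s => f (y (j, s)))
    fun t ht => by rw [← hf, h t ht]
  rw [hf]
  exact Finset.sum_eq_zero fun s _ => by rw [congrFun hu s]; simp

end EvaluationPoints

section LocallyRepairableCode

variable {F K : Type*} [Field F] [Fintype F] [Field K] [Algebra F K] {r g L α : ℕ}

/-- Concatenation of a Gabidulin code with a Reed–Solomon code in each of the `g` local groups. -/
noncomputable def lrcEncode (x : Fin L → F) (y : (Fin g × Fin α) × Fin r → K) (M : ℕ) :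
    (Fin M → K) →ₗ[K] (Fin g × Fin L → Fin α → K) where
  toFun c p a := linearizedEval F K M c (encodedPoint x y (p.1, a) p.2)
  map_add' c c' := by ext; simp
  map_smul' k c := by ext; simp

variable [DecidableEq K] {x : Fin L → F} {y : (Fin g × Fin α) × Fin r → K} {M : ℕ}

theorem lrcEncode_card_local_zeros_lt (hx : Function.Injective x) {c : Fin M → K} {j : Fin g}
    {t₀ : Fin L} (h : lrcEncode x y M c (j, t₀) ≠ 0) :
    (Finset.univ.filter fun t => lrcEncode x y M c (j, t) = 0).card < r := by
  by_contra! hr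
  refine h (funext fun a => map_encodedPoint_eq_zero hx y _ (j, a) hr (fun t ht => ?_) t₀)
  exact congrFun (Finset.mem_filter.1 ht).2 a

theorem lrcEncode_sum_min_lt [Fintype K] (hx : Function.Injective x) (hy : LinearIndependent F y)
    {c : Fin M → K} (hc : c ≠ 0) :
    (∑ j, min r (Finset.univ.filter fun t => lrcEncode x y M c (j, t) = 0).card) * α < M := by
  have hex : ∀ j, ∃ T ⊆ Finset.univ.filter (fun t => lrcEncode x y M c (j, t) = 0),
      T.card = min r (Finset.univ.filter fun t => lrcEncode x y M c (j, t) = 0).card :=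
    fun j => Finset.exists_subset_card_eq (min_le_right _ _)
  choose T hTsub hTcard using hex
  have hlt := card_lt_of_linearizedEval_eq_zero hc
    (linearIndependent_encodedPoint hx hy (fun p => T p.1)
      fun p => (hTcard p.1).trans_le (min_le_left _ _))
    fun p => congrFun (Finset.mem_filter.1 (hTsub _ p.2.2)).2 p.1.2
  simpa [Fintype.card_sigma, Fintype.sum_prod_type, hTcard, Finset.mul_sum, mul_comm] using hlt

theorem sum_le_add_div_mul {ι : Type*} [Fintype ι] {r d κ : ℕ} (hr : 0 < r) {s : ι → ℕ}
    (hs : ∀ j, s j ≤ r + d) (h : ∑ j, min r (s j) ≤ κ) : ∑ j, s j ≤ κ + κ / r * d := by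
  have hB : (Finset.univ.filter fun j => r ≤ s j).card ≤ κ / r := by
    rw [Nat.le_div_iff_mul_le hr]
    calc (Finset.univ.filter fun j => r ≤ s j).card * r
        = ∑ j, if r ≤ s j then r else 0 := by rw [← Finset.sum_filter]; simp
      _ ≤ ∑ j, min r (s j) := Finset.sum_le_sum fun j _ => by split_ifs <;> omega
      _ ≤ κ := h
  calc ∑ j, s j ≤ ∑ j, (min r (s j) + if r ≤ s j then d else 0) :=
        Finset.sum_le_sum fun j _ => by have := hs j; split_ifs <;> omega
    _ = ∑ j, min r (s j) + (Finset.univ.filter fun j => r ≤ s j).card * d := by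
        rw [Finset.sum_add_distrib, ← Finset.sum_filter]; simp
    _ ≤ _ := Nat.add_le_add h (Nat.mul_le_mul_right _ hB)

theorem lrcEncode_card_zeros_le [Fintype K] {d : ℕ} (hr : 0 < r) (hα : 0 < α) (hL : L = r + d)
    (hx : Function.Injective x) (hy : LinearIndependent F y) {c : Fin M → K} (hc : c ≠ 0) :
    (Finset.univ.filter fun p => lrcEncode x y M c p = 0).card ≤
      (M - 1) / α + (M - 1) / α / r * d := by
  have hsum : (Finset.univ.filter fun p => lrcEncode x y M c p = 0).card =
      ∑ j, (Finset.univ.filter fun t => lrcEncode x y M c (j, t) = 0).card := by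
    simp only [Finset.card_filter, Fintype.sum_prod_type]
  rw [hsum]
  refine sum_le_add_div_mul hr (fun j => (Finset.card_le_univ _).trans (by simp [hL])) ?_
  rw [Nat.le_div_iff_mul_le hα]
  exact Nat.le_sub_one_of_lt (lrcEncode_sum_min_lt hx hy hc)

theorem exists_le_card_zeros_lrcEncode {d κ : ℕ} (hr : 0 < r) (hL : L = r + d)
    (hx : Function.Injective x) (hκ : κ * α < M) (hκg : κ < g * r) :
    ∃ c : Fin M → K, c ≠ 0 ∧
      κ + κ / r * d ≤ (Finset.univ.filter fun p => lrcEncode x y M c p = 0).card := by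
  have hb : κ / r < g := Nat.div_lt_of_lt_mul (by rwa [mul_comm])
  have hrL : r ≤ L := by omega
  let pos : Fin κ → Fin g × Fin L := fun e =>
    (⟨e / r, (Nat.div_le_div_right e.2.le).trans_lt hb⟩, ⟨e % r, (Nat.mod_lt _ hr).trans_le hrL⟩)
  let ψ : (Fin M → K) →ₗ[K] (Fin κ × Fin α → K) :=
    { toFun := fun c e => lrcEncode x y M c (pos e.1) e.2
      map_add' := fun c c' => by ext; simp
      map_smul' := fun k c => by ext; simp }
  obtain ⟨c, hψ, hc⟩ := (Submodule.ne_bot_iff _).1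
    (LinearMap.ker_ne_bot_of_finrank_lt (f := ψ) (by simpa using hκ))
  have hzero : ∀ (j : Fin g) (t : Fin L), (t : ℕ) < r → r * j + t < κ →
      lrcEncode x y M c (j, t) = 0 := by
    intro j t ht hlt
    funext a
    have h := congrFun (LinearMap.mem_ker.1 hψ) (⟨r * j + t, hlt⟩, a)
    have hpos : pos ⟨r * j + t, hlt⟩ = (j, t) := by
      ext
      · simp [pos, Nat.mul_add_div hr, Nat.div_eq_of_lt ht]
      · simp [pos, Nat.mod_eq_of_lt ht]
    simpa [ψ, hpos] using h
  have hmod := Nat.div_add_mod κ r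
  have hfull : ∀ (j : Fin g) (t : Fin L), (j : ℕ) < κ / r → lrcEncode x y M c (j, t) = 0 := by
    intro j t hj
    funext a
    refine map_encodedPoint_eq_zero hx y _ (j, a)
      (T := Finset.univ.map (Fin.castLEEmb hrL)) (by simp) (fun t' ht' => ?_) t
    obtain ⟨s, -, rfl⟩ := Finset.mem_map.1 ht'
    refine congrFun (hzero j (Fin.castLE hrL s) s.2 ?_) a
    have h1 : r * ((j : ℕ) + 1) ≤ r * (κ / r) := Nat.mul_le_mul_left _ hj
    have h2 := s.2
    simp only [Fin.val_castLE]
    rw [mul_add] at h1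
    omega
  have hmodlt := Nat.mod_lt κ hr
  let place : (Fin (κ / r) × Fin L) ⊕ Fin (κ % r) → Fin g × Fin L :=
    Sum.elim (fun p => (Fin.castLE hb.le p.1, p.2))
      (fun s => (⟨κ / r, hb⟩, ⟨s, s.2.trans (hmodlt.trans_le hrL)⟩))
  have hplace : Function.Injective place := by
    refine Function.Injective.sumElim ?_ ?_ ?_
    · rintro ⟨j, t⟩ ⟨j', t'⟩ h
      simpa using h
    · intro s s' h
      simpa [Fin.ext_iff] using h
    · rintro ⟨j, t⟩ s h
      have := congrArg (fun p => (p.1 : ℕ)) h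
      exact j.2.ne (by simpa using this)
  refine ⟨c, hc, ?_⟩
  calc κ + κ / r * d = Fintype.card ((Fin (κ / r) × Fin L) ⊕ Fin (κ % r)) := by
        simp only [Fintype.card_sum, Fintype.card_prod, Fintype.card_fin, hL]
        rw [mul_add, mul_comm (κ / r) r]
        omega
    _ = (Finset.univ.map ⟨place, hplace⟩).card := by simp
    _ ≤ _ := Finset.card_le_card fun p hp => by
        obtain ⟨e, -, rfl⟩ := Finset.mem_map.1 hp
        refine Finset.mem_filter.2 ⟨Finset.mem_univ _, ?_⟩
        rcases e with ⟨j, t⟩ | s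
        · exact hfull _ _ j.2
        · refine hzero _ _ (s.2.trans hmodlt) ?_
          have := s.2
          simp only
          omega

end LocallyRepairableCode

theorem hammingDist_add_card_zeros {ι P A : Type*} [Fintype ι] [Fintype P] [AddGroup A]
    [DecidableEq A] (e : P ≃ ι) {u v : ι → A} {w : P → A} (h : ∀ p, u (e p) - v (e p) = w p) :
    hammingDist u v + (Finset.univ.filter fun p => w p = 0).card = Fintype.card ι := by
  have hzero : (Finset.univ.filter fun p => w p = 0).card =
      (Finset.univ.filter fun i => u i = v i).card :=
    Finset.card_equiv e fun p => by simp [← h, sub_eq_zero]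
  rw [hzero, hammingDist, add_comm]
  exact Finset.card_filter_add_card_filter_not _

theorem minDist_eq {n : ℕ} {A : Type*} [DecidableEq A] {C : Set (Fin n → A)} {D : ℕ}
    (hlow : ∀ c ∈ C, ∀ c' ∈ C, c ≠ c' → D ≤ hammingDist c c')
    (hup : ∃ c ∈ C, ∃ c' ∈ C, c ≠ c' ∧ hammingDist c c' ≤ D) : minDist C = D := by
  obtain ⟨c, hc, c', hc', hne, hle⟩ := hup
  refine le_antisymm (le_trans (Nat.sInf_le ?_) hle) ?_
  · exact ⟨c, hc, c', hc', hne, rfl⟩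
  refine le_csInf ⟨_, c, hc, c', hc', hne, rfl⟩ ?_
  rintro _ ⟨u, hu, v, hv, huv, rfl⟩
  exact hlow u hu v hv huv

theorem ceil_natCast_div_eq {a b : ℕ} (ha : 0 < a) (hb : 0 < b) :
    ⌈(a : ℚ) / b⌉ = ((a - 1) / b : ℕ) + 1 := by
  have hb' : (0 : ℚ) < b := by exact_mod_cast hb
  have hlt := Nat.lt_div_mul_add hb (a := a - 1)
  have hle := Nat.div_mul_le_self (a - 1) b
  rw [Int.ceil_eq_iff]
  constructor
  · rw [lt_div_iff₀ hb']
    push_cast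
    rw [add_sub_cancel_right]
    exact_mod_cast (by omega : (a - 1) / b * b < a)
  · rw [div_le_iff₀ hb']
    push_cast
    rw [add_mul, one_mul]
    exact_mod_cast (by omega : a ≤ (a - 1) / b * b + b)

/-- **Existence of `d_min`-optimal `(r, δ, α)` locally repairable codes, case
`(r + δ - 1) ∣ n`** (Construction I / Theorem 4 of
Rawat–Koyluoglu–Silberstein–Vishwanath).  Let `q ≥ r + δ - 1` be a prime power, let
`N = n r α / (r + δ - 1)` (stated as `N * (r + δ - 1) = n * r * α`), `m ≥ N`, and let
`K` be a finite field with `|K| = q^m`.  Then for every `𝓜` with `r α ≤ 𝓜 ≤ N` there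
is a code `C` of length `n` over `K^α` with `|C| = (q^m)^𝓜`, `(r, δ)` locality, and
minimum distance exactly `n - ⌈𝓜/α⌉ + 1 - (⌈𝓜/(rα)⌉ - 1)(δ - 1)`. -/
theorem lrc_optimal_construction_divisible
    (r δ α n q m N : ℕ)
    (hr : 1 ≤ r) (hδ : 2 ≤ δ) (hα : 1 ≤ α)
    (hn : r + δ - 1 < n) (hdvd : (r + δ - 1) ∣ n)
    (hq : IsPrimePow q) (hqrd : r + δ - 1 ≤ q)
    (hN : N * (r + δ - 1) = n * r * α) (hm : N ≤ m)
    (K : Type) [Field K] [Fintype K] [DecidableEq K] (hK : Fintype.card K = q ^ m)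
    (M : ℕ) (hM1 : r * α ≤ M) (hM2 : M ≤ N) :
    ∃ C : Finset (Fin n → (Fin α → K)),
      C.card = (q ^ m) ^ M ∧
      HasLocality (↑C : Set (Fin n → (Fin α → K))) r δ ∧
      (minDist (↑C : Set (Fin n → (Fin α → K))) : ℤ) =
        (n : ℤ) - ⌈(M : ℚ) / α⌉ + 1 - (⌈(M : ℚ) / (r * α)⌉ - 1) * ((δ : ℤ) - 1) := by
  have hL0 : 0 < r + δ - 1 := by omega
  obtain ⟨g, hg⟩ := hdvd
  have hL : r + δ - 1 = r + (δ - 1) := by omega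
  generalize r + δ - 1 = L at *
  have hNg : N = g * α * r := by
    apply Nat.eq_of_mul_eq_mul_right hL0
    rw [hN, hg]
    ring
  have hM0 : 0 < M := (Nat.mul_pos hr hα).trans_le hM1
  obtain ⟨F, _, _, _, hF⟩ := exists_field_algebra_of_card_eq_pow hq (by omega) hK
  have hfin : Module.finrank F K = m := by
    have h := Module.card_eq_pow_finrank (K := F) (V := K)
    rw [hK, hF] at h
    exact (Nat.pow_right_injective hq.two_le h).symm
  obtain ⟨x⟩ : Nonempty (Fin L ↪ F) :=
    Function.Embedding.nonempty_of_card_le (by simpa [hF] using hqrd)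
  obtain ⟨b⟩ : Nonempty ((Fin g × Fin α) × Fin r ↪ Fin (Module.finrank F K)) :=
    Function.Embedding.nonempty_of_card_le (by simpa [hfin, ← hNg] using hm)
  let y : (Fin g × Fin α) × Fin r → K := fun p => Module.finBasis F K (b p)
  have hy : LinearIndependent F y :=
    (Module.finBasis F K).linearIndependent.comp b b.injective
  let e : Fin g × Fin L ≃ Fin n :=
    Fintype.equivOfCardEq (by simp [hg, mul_comm])
  let enc : (Fin M → K) → Fin n → Fin α → K := fun c i => lrcEncode x y M c (e.symm i)
  have hdist : ∀ c c', hammingDist (enc c) (enc c') +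
      (Finset.univ.filter fun p => lrcEncode x y M (c - c') p = 0).card = n := fun c c' => by
    have h := hammingDist_add_card_zeros e (u := enc c) (v := enc c')
      (w := lrcEncode x y M (c - c')) fun p => by simp [enc]
    simpa using h
  set κ := (M - 1) / α with hκ
  have hκM : κ * α < M := (Nat.div_mul_le_self _ _).trans_lt (by omega)
  have hκg : κ < g * r := by
    refine lt_of_mul_lt_mul_right (hκM.trans_le (hM2.trans_eq ?_)) (Nat.zero_le α)
    rw [hNg]
    ring
  have hzeros : ∀ c : Fin M → K, c ≠ 0 →
      (Finset.univ.filter fun p => lrcEncode x y M c p = 0).card ≤ κ + κ / r * (δ - 1) :=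
    fun c hc => lrcEncode_card_zeros_le hr hα hL x.injective hy hc
  have hbound : κ + κ / r * (δ - 1) < n := by
    have h1 : κ / r + 1 ≤ g := Nat.div_lt_of_lt_mul (by rwa [mul_comm])
    have h2 : (κ / r + 1) * (δ - 1) ≤ g * (δ - 1) := Nat.mul_le_mul_right _ h1
    have h3 : n = g * r + g * (δ - 1) := by rw [hg, hL]; ring
    rw [add_mul] at h2
    omega
  have hinj : Function.Injective enc := by
    intro c c' h
    by_contra hne
    have h1 := hdist c c'
    have h2 := hzeros _ (sub_ne_zero.2 hne)
    rw [h, hammingDist_self] at h1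
    omega
  refine ⟨Finset.univ.image enc, ?_, ?_, ?_⟩
  · rw [Finset.card_image_of_injective _ hinj]
    simp [hK]
  · intro i
    let Γ : Finset (Fin n) := Finset.univ.map
      ⟨fun t => e ((e.symm i).1, t), fun t t' h => by simpa using h⟩
    have hmem : ∀ t, e ((e.symm i).1, t) ∈ Γ := fun t =>
      Finset.mem_map.2 ⟨t, Finset.mem_univ _, rfl⟩
    let eΓ : Fin L ≃ Γ := Equiv.ofBijective (fun t => ⟨e ((e.symm i).1, t), hmem t⟩)
      ⟨fun t t' h => by simpa using h, fun ⟨k, hk⟩ => by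
        obtain ⟨t, -, rfl⟩ := Finset.mem_map.1 hk
        exact ⟨t, rfl⟩⟩
    have heΓ : ∀ t, e.symm (eΓ t) = ((e.symm i).1, t) := fun t => e.symm_apply_apply _
    have hΓ : Γ.card = L := by simp [Γ]
    refine ⟨Γ, by simpa using hmem (e.symm i).2, by rw [hΓ, hL]; omega, ?_⟩
    rintro _ ⟨_, hc, rfl⟩ _ ⟨_, hc', rfl⟩ hne
    obtain ⟨c, rfl⟩ : ∃ c, enc c = _ := by simpa using hc
    obtain ⟨c', rfl⟩ : ∃ c', enc c' = _ := by simpa using hc'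
    have hsum := hammingDist_add_card_zeros eΓ (u := fun k : Γ => enc c k)
      (v := fun k : Γ => enc c' k)
      (w := fun t => lrcEncode x y M (c - c') ((e.symm i).1, t)) fun t => by simp [enc, heΓ]
    change δ ≤ hammingDist (fun k : Γ => enc c k) fun k : Γ => enc c' k
    obtain ⟨k, hk⟩ := Function.ne_iff.1 hne
    obtain ⟨t, rfl⟩ := eΓ.surjective k
    have hlt := lrcEncode_card_local_zeros_lt (y := y) x.injective (c := c - c')
      (j := (e.symm i).1) (t₀ := t) (by simpa [enc, heΓ, sub_eq_zero] using hk)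
    rw [Fintype.card_coe, hΓ] at hsum
    omega
  · rw [minDist_eq (D := n - (κ + κ / r * (δ - 1))), ceil_natCast_div_eq hM0 hα]
    · have h := ceil_natCast_div_eq hM0 (Nat.mul_pos hr hα)
      rw [mul_comm r α, ← Nat.div_div_eq_div_mul, ← hκ, mul_comm α r] at h
      push_cast at h
      rw [h, ← hκ, Nat.cast_sub hbound.le]
      push_cast [Nat.cast_sub (show 1 ≤ δ by omega)]
      ring
    · intro u hu v hv huv
      obtain ⟨c, rfl⟩ : ∃ c, enc c = u := by simpa using hu
      obtain ⟨c', rfl⟩ : ∃ c', enc c' = v := by simpa using hv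
      have h1 := hdist c c'
      have h2 := hzeros (c - c') (sub_ne_zero.2 fun h => huv (congrArg enc h))
      omega
    · obtain ⟨c, hc, hcard⟩ := exists_le_card_zeros_lrcEncode (y := y) hr hL x.injective hκM hκg
      refine ⟨enc c, by simp, enc 0, by simp, hinj.ne hc, ?_⟩
      have h1 := hdist c 0
      rw [sub_zero] at h1
      omega
end

section
/- Let r ≥ 1, δ ≥ 2, α ≥ 1 and n > r + δ − 1 be integers with (r + δ − 1) ∤ n; set g = ⌊n/(r+δ−1)⌋ + 1, β₀ = (n mod (r+δ−1)) − (δ−1), and N = (g−1)·r·α + β₀·α. Let 𝓜 be an integer with r·α ≤ 𝓜 ≤ N such that 0 < (⌈𝓜/α⌉ mod r) ≤ β₀. Let q be a prime power with q ≥ r + δ − 1, let m ≥ N be an integer, and let K be a finite field with |K| = q^m. Then there exists a code C of length n over the alphabet K^α with |C| = (q^m)^𝓜 that has (r, δ) locality and whose minimum distance equals n − ⌈𝓜/α⌉ + 1 − (⌈𝓜/(r·α)⌉ − 1)·(δ − 1), attaining the minimum-distance upper bound for (r, δ, α) locally repairable codes. -/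
/-- The `q`-linearized polynomial `∑ aᵢ X^(q^i)`, `q = |F|`, as an `F`-linear map. -/
noncomputable def linearizedMap (F : Type*) {K : Type*} [Field F] [Fintype F] [Field K]
    [Algebra F K] {M : ℕ} (a : Fin M → K) : K →ₗ[F] K :=
  ∑ i, LinearMap.mulLeft F (a i) ∘ₗ ((FiniteField.frobeniusAlgHom F K) ^ (i : ℕ)).toLinearMap

theorem linearizedMap_apply {F K : Type*} [Field F] [Fintype F] [Field K] [Algebra F K]
    {M : ℕ} (a : Fin M → K) (z : K) :
    linearizedMap F a z = ∑ i, a i * z ^ Fintype.card F ^ (i : ℕ) := by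
  simp [linearizedMap, AlgHom.coe_pow, FiniteField.coe_frobeniusAlgHom, pow_iterate]

open Polynomial in
/-- Two `q`-linearized polynomials with `M` coefficients that agree on at least `M` linearly
independent points are equal. -/
theorem eq_of_linearizedMap_eq {F K κ : Type*} [Field F] [Fintype F] [Field K] [Fintype K]
    [Algebra F K] [Fintype κ] {M : ℕ} {a a' : Fin M → K} {v : κ → K}
    (hv : LinearIndependent F v) (hM : M ≤ Fintype.card κ)
    (h : ∀ i, linearizedMap F a (v i) = linearizedMap F a' (v i)) : a = a' := by
  classical
  set q := Fintype.card F with hq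
  have hq1 : 1 < q := Fintype.one_lt_card
  set p : K[X] := ∑ i : Fin M, C (a i - a' i) * X ^ q ^ (i : ℕ) with hp
  let W := Submodule.span F (Set.range v)
  have heval : ∀ z ∈ W, p.eval z = 0 := by
    intro z hz
    have hle : W ≤ LinearMap.ker (linearizedMap F a - linearizedMap F a') := by
      refine Submodule.span_le.2 ?_
      rintro _ ⟨i, rfl⟩
      simp [h i]
    have hz' := hle hz
    rw [LinearMap.mem_ker, LinearMap.sub_apply, linearizedMap_apply, linearizedMap_apply,
      ← Finset.sum_sub_distrib] at hz'
    rw [← hz', hp, eval_finsetSum]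
    exact Finset.sum_congr rfl fun i _ => by simp [sub_mul, hq]
  have hcard : ((W : Set K).toFinset).card = q ^ Fintype.card κ := by
    rw [Set.toFinset_card, ← finrank_span_eq_card hv]
    exact Module.card_eq_pow_finrank (K := F) (V := W)
  have hdeg : p.natDegree < q ^ M := by
    rcases Nat.eq_zero_or_pos M with rfl | hpos
    · simp [hp]
    refine lt_of_le_of_lt (natDegree_sum_le_of_forall_le (n := q ^ (M - 1)) _ _ ?_)
      (Nat.pow_lt_pow_right hq1 (by omega))
    intro i _
    exact (natDegree_C_mul_X_pow_le _ _).trans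
      (Nat.pow_le_pow_right (by omega) (by omega))
  have hp0 : p = 0 := by
    refine eq_zero_of_natDegree_lt_card_of_eval_eq_zero' p (W : Set K).toFinset
      (fun z hz => heval z (by simpa using hz)) ?_
    rw [hcard]
    exact hdeg.trans_le (Nat.pow_le_pow_right (by omega) hM)
  funext i
  have hc : p.coeff (q ^ (i : ℕ)) = a i - a' i := by
    rw [hp, finsetSum_coeff, Finset.sum_eq_single i]
    · rw [coeff_C_mul_X_pow, if_pos rfl]
    · intro j _ hj
      rw [coeff_C_mul_X_pow, if_neg]
      intro he
      exact hj (Fin.ext (Nat.pow_right_injective hq1 he).symm)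
    · simp
  rw [hp0, coeff_zero] at hc
  exact (sub_eq_zero.1 hc.symm)

/-- Evaluation points of the local Reed–Solomon codes: the coordinate `x` lies in the group
`gp x`, which has dimension `k (gp x)` and its own linearly independent points `e`. -/
noncomputable def localPoint {F K ι J : Type*} [Field F] [Field K] [Algebra F K] [Fintype J]
    [DecidableEq J] {α : ℕ} {k : J → ℕ} (gp : ι → J) (ω : ι → F)
    (e : (Σ j, Fin (k j)) × Fin α → K) (x : ι) (t : Fin α) : K :=
  ∑ s : Σ j, Fin (k j), (if s.1 = gp x then ω x ^ (s.2 : ℕ) else 0) • e (s, t)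

open Polynomial in
theorem linearIndependent_localPoint {F K ι J : Type*} [Field F] [Field K] [Algebra F K]
    [Fintype J] [DecidableEq J] {α : ℕ} {k : J → ℕ} {gp : ι → J} {ω : ι → F}
    {e : (Σ j, Fin (k j)) × Fin α → K}
    (hω : ∀ x y, gp x = gp y → ω x = ω y → x = y) (he : LinearIndependent F e)
    (T : Finset ι) (hT : ∀ j, (T.filter (gp · = j)).card ≤ k j) :
    LinearIndependent F (fun p : T × Fin α => localPoint gp ω e p.1 p.2) := by
  classical
  rw [Fintype.linearIndependent_iff] at he ⊢
  intro c hc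
  have hcoeff := he (fun p => ∑ x : T, c (x, p.2) *
      (if p.1.1 = gp x then ω x ^ (p.1.2 : ℕ) else 0)) (by
    rw [← hc, Fintype.sum_prod_type_right, Fintype.sum_prod_type_right]
    refine Finset.sum_congr rfl fun t _ => ?_
    simp only [localPoint, Finset.smul_sum, Finset.sum_smul, mul_smul]
    exact Finset.sum_comm)
  rintro ⟨x₀, t⟩
  set j := gp x₀ with hj
  set B := (T.filter (gp · = j)).erase x₀ with hB
  have hx₀ : (x₀ : ι) ∈ T.filter (gp · = j) := by simp [hj]
  set h : F[X] := ∏ y ∈ B, (X - C (ω y)) with hh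
  have hdeg : h.natDegree < k j := by
    rw [hh, natDegree_prod_of_monic _ _ fun y _ => monic_X_sub_C _]
    simp only [natDegree_X_sub_C, Finset.sum_const, smul_eq_mul, mul_one, hB]
    have := hT j
    have h1 := Finset.card_erase_lt_of_mem hx₀
    omega
  have hsum : ∑ x : T, c (x, t) * (if j = gp x then h.eval (ω x) else 0) = 0 := by
    have hi : ∀ i ∈ Finset.range (k j),
        h.coeff i * ∑ x : T, c (x, t) * (if j = gp x then ω x ^ i else 0) = 0 := by
      intro i hi
      rw [show ∑ x : T, c (x, t) * (if j = gp x then ω x ^ i else 0) = 0 from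
        hcoeff (⟨j, ⟨i, Finset.mem_range.1 hi⟩⟩, t), mul_zero]
    refine Eq.trans ?_ (Finset.sum_eq_zero hi)
    simp only [Finset.mul_sum]
    rw [Finset.sum_comm]
    refine Finset.sum_congr rfl fun x _ => ?_
    split_ifs
    · rw [eval_eq_sum_range' hdeg, Finset.mul_sum]
      exact Finset.sum_congr rfl fun i _ => by ring
    · simp
  rw [Finset.sum_eq_single x₀] at hsum
  · rw [if_pos hj] at hsum
    refine (mul_eq_zero.1 hsum).resolve_right ?_
    rw [hh, eval_prod, ← ne_eq, Finset.prod_ne_zero_iff]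
    intro y hy
    have hy' := Finset.mem_erase.1 hy
    have hgy := (Finset.mem_filter.1 hy'.2).2
    simp only [eval_sub, eval_X, eval_C]
    exact sub_ne_zero.2 fun hxy => hy'.1 (hω _ _ hgy hxy.symm)
  · intro x _ hx
    split_ifs with hxj
    · rw [hh, eval_prod, Finset.prod_eq_zero (i := (x : ι))]
      · simp
      · exact Finset.mem_erase.2 ⟨fun h' => hx (Subtype.ext h'),
          Finset.mem_filter.2 ⟨x.2, hxj.symm⟩⟩
      · simp
    · simp
  · simp

/-- The codeword of the message `a`: the linearized polynomial with coefficients `a`, evaluated at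
the points of the local Reed–Solomon codes. -/
noncomputable def encode {F K ι J : Type*} [Field F] [Fintype F] [Field K] [Algebra F K]
    [Fintype J] [DecidableEq J] {α M : ℕ} {k : J → ℕ} (gp : ι → J) (ω : ι → F)
    (e : (Σ j, Fin (k j)) × Fin α → K) (a : Fin M → K) : ι → Fin α → K :=
  fun x t => linearizedMap F a (localPoint gp ω e x t)

open Polynomial in
/-- Codewords that agree on `k j` coordinates of the group `j` agree on the whole group. -/
theorem encode_eq_of_eqOn_group {F K ι J : Type*} [Field F] [Fintype F] [Field K] [Algebra F K]
    [Fintype J] [DecidableEq J] {α M : ℕ} {k : J → ℕ} {gp : ι → J} {ω : ι → F}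
    {e : (Σ j, Fin (k j)) × Fin α → K}
    (hω : ∀ x y, gp x = gp y → ω x = ω y → x = y) {a a' : Fin M → K} {j : J} {B : Finset ι}
    (hBj : ∀ x ∈ B, gp x = j) (hB : k j ≤ B.card)
    (h : ∀ x ∈ B, encode gp ω e a x = encode gp ω e a' x) {x : ι} (hx : gp x = j) :
    encode gp ω e a x = encode gp ω e a' x := by
  classical
  funext t
  let P : (Fin M → K) → K[X] := fun b =>
    ∑ i : Fin (k j), C (linearizedMap F b (e (⟨j, i⟩, t))) * X ^ (i : ℕ)
  have hP : ∀ b y, gp y = j → encode gp ω e b y t = (P b).eval (algebraMap F K (ω y)) := by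
    intro b y hy
    simp only [encode, localPoint, P, map_sum, map_smul, eval_finsetSum, eval_mul, eval_C,
      eval_pow, eval_X, hy]
    rw [Fintype.sum_sigma, Finset.sum_eq_single j]
    · exact Finset.sum_congr rfl fun i _ => by
        simp [Algebra.smul_def, mul_comm]
    · intro j' _ hj'
      simp [hj']
    · simp
  have hdeg : ∀ b, (P b).degree < B.card := fun b =>
    (degree_sum_fin_lt _).trans_le (by exact_mod_cast hB)
  have hPP : P a = P a' := by
    refine eq_of_degrees_lt_of_eval_index_eq (v := fun y => algebraMap F K (ω y)) B ?_
      (hdeg a) (hdeg a') ?_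
    · intro y hy z hz hyz
      exact hω y z ((hBj y hy).trans (hBj z hz).symm) ((algebraMap F K).injective hyz)
    · intro y hy
      rw [← hP a y (hBj y hy), ← hP a' y (hBj y hy), h y hy]
  rw [hP a x hx, hP a' x hx, hPP]

/-- A set of coordinates of total rank at least `M / α` determines the message. -/
theorem eq_of_encode_eqOn {F K ι J : Type*} [Field F] [Fintype F] [Field K] [Fintype K]
    [Algebra F K] [Fintype J] [DecidableEq J] {α M : ℕ} {k : J → ℕ} {gp : ι → J} {ω : ι → F}
    {e : (Σ j, Fin (k j)) × Fin α → K}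
    (hω : ∀ x y, gp x = gp y → ω x = ω y → x = y) (he : LinearIndependent F e)
    {a a' : Fin M → K} {S : Finset ι}
    (hS : M ≤ (∑ j, min (S.filter (gp · = j)).card (k j)) * α)
    (h : ∀ x ∈ S, encode gp ω e a x = encode gp ω e a' x) : a = a' := by
  classical
  have hex : ∀ j, ∃ T ⊆ S.filter (gp · = j), T.card = min (S.filter (gp · = j)).card (k j) :=
    fun j => Finset.exists_subset_card_eq (min_le_left _ _)
  choose T hTS hTc using hex
  have hgp : ∀ j, ∀ x ∈ T j, gp x = j := fun j x hx => (Finset.mem_filter.1 (hTS j hx)).2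
  set U := Finset.univ.biUnion T with hU
  have hUj : ∀ j, U.filter (gp · = j) = T j := by
    intro j
    ext x
    simp only [hU, Finset.mem_filter, Finset.mem_biUnion, Finset.mem_univ, true_and]
    constructor
    · rintro ⟨⟨i, hi⟩, rfl⟩
      rwa [hgp i x hi]
    · exact fun hx => ⟨⟨j, hx⟩, hgp j x hx⟩
  have hUc : U.card = ∑ j, min (S.filter (gp · = j)).card (k j) := by
    rw [Finset.card_eq_sum_card_fiberwise (f := gp) (t := Finset.univ) (by simp)]
    exact Finset.sum_congr rfl fun j _ => by rw [hUj, hTc]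
  refine eq_of_linearizedMap_eq (linearIndependent_localPoint hω he U fun j => ?_) ?_ ?_
  · rw [hUj, hTc]
    exact min_le_right _ _
  · simpa [hUc] using hS
  · rintro ⟨⟨x, hx⟩, t⟩
    obtain ⟨j, -, hxj⟩ := Finset.mem_biUnion.1 hx
    exact congrFun (h x (Finset.mem_filter.1 (hTS j hxj)).1) t

/-- A finite field with `q ^ m` elements, `q` a prime power and `m > 0`, has a subfield with `q`
elements. -/
theorem exists_algebra_card_eq {K : Type} [Field K] [Fintype K] {q m : ℕ} (hq : IsPrimePow q)
    (hm : m ≠ 0) (hK : Fintype.card K = q ^ m) :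
    ∃ (F : Type) (_ : Field F) (_ : Fintype F) (_ : Algebra F K),
      Fintype.card F = q ∧ Module.finrank F K = m := by
  obtain ⟨p, s, hp, hs, rfl⟩ := hq
  have hp' : p.Prime := hp.nat_prime
  have : Fact p.Prime := ⟨hp'⟩
  have hchar : CharP K p := by
    have : ((p : ℕ) : K) = 0 := by
      have h := Nat.cast_card_eq_zero K
      rw [hK, ← pow_mul, Nat.cast_pow] at h
      exact (pow_eq_zero_iff (mul_ne_zero hs.ne' hm)).1 h
    exact (CharP.charP_iff_prime_eq_zero hp').2 this
  let _ : Algebra (ZMod p) K := ZMod.algebra K p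
  have hfin : Module.finrank (ZMod p) K = s * m := by
    have h := Module.card_eq_pow_finrank (K := ZMod p) (V := K)
    rw [hK, ZMod.card, ← pow_mul] at h
    exact (Nat.pow_right_injective hp'.two_le h).symm
  let _ : Fintype (GaloisField p s) := Fintype.ofFinite _
  have hcard : Fintype.card (GaloisField p s) = p ^ s := by
    rw [← Nat.card_eq_fintype_card, GaloisField.card p s hs.ne']
  obtain ⟨φ⟩ : Nonempty (GaloisField p s →ₐ[ZMod p] K) := by
    rw [FiniteField.nonempty_algHom_iff_finrank_dvd, hfin, GaloisField.finrank p hs.ne']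
    exact dvd_mul_right _ _
  let _ : Algebra (GaloisField p s) K := φ.toRingHom.toAlgebra
  refine ⟨GaloisField p s, inferInstance, inferInstance, inferInstance, hcard, ?_⟩
  have h := Module.card_eq_pow_finrank (K := GaloisField p s) (V := K)
  rw [hK, hcard] at h
  exact (Nat.pow_right_injective (Nat.one_lt_pow hs.ne' hp'.one_lt) h).symm

/-- Fewer than `M / α` information coordinates do not determine the message, although they
determine the codeword on all the groups they span. -/
theorem exists_ne_encode_eqOn {F K ι J : Type*} [Field F] [Fintype F] [Field K] [Fintype K]
    [Algebra F K] [Fintype ι] [Fintype J] [DecidableEq J] {α M : ℕ} {k : J → ℕ} {gp : ι → J}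
    {ω : ι → F} {e : (Σ j, Fin (k j)) × Fin α → K}
    (hω : ∀ x y, gp x = gp y → ω x = ω y → x = y)
    (hgp : ∀ j, k j ≤ (Finset.univ.filter (gp · = j)).card) (A : Finset J) (E : Finset ι)
    (hM : (∑ j ∈ A, k j + E.card) * α < M) :
    ∃ a a' : Fin M → K, a ≠ a' ∧
      ∀ x, gp x ∈ A ∨ x ∈ E → encode gp ω e a x = encode gp ω e a' x := by
  classical
  choose T hTS hTc using fun j => Finset.exists_subset_card_eq (hgp j)
  set B := A.biUnion T ∪ E with hB
  have hBc : B.card ≤ ∑ j ∈ A, k j + E.card := by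
    refine (Finset.card_union_le _ _).trans (Nat.add_le_add_right ?_ _)
    exact Finset.card_biUnion_le.trans (Finset.sum_le_sum fun j _ => (hTc j).le)
  have hlt : Fintype.card (B → Fin α → K) < Fintype.card (Fin M → K) := by
    simp only [Fintype.card_fun, Fintype.card_fin, Fintype.card_coe, ← pow_mul]
    refine Nat.pow_lt_pow_right Fintype.one_lt_card ?_
    rw [mul_comm]
    exact (Nat.mul_le_mul_right α hBc).trans_lt hM
  obtain ⟨a, a', hne, h⟩ := Fintype.exists_ne_map_eq_of_card_lt
    (fun (a : Fin M → K) (x : B) => encode gp ω e a x) hlt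
  have hagree : ∀ x ∈ B, encode gp ω e a x = encode gp ω e a' x :=
    fun x hx => congrFun h ⟨x, hx⟩
  refine ⟨a, a', hne, fun x hx => ?_⟩
  rcases hx with hx | hx
  · refine encode_eq_of_eqOn_group hω (j := gp x) (B := T (gp x))
      (fun y hy => (Finset.mem_filter.1 (hTS _ hy)).2) (hTc _).ge (fun y hy => ?_) rfl
    exact hagree y (Finset.mem_union_left _ (Finset.mem_biUnion.2 ⟨_, hx, hy⟩))
  · exact hagree x (Finset.mem_union_right _ hx)

theorem hasLocality_range_encode {F K J : Type*} [Field F] [Fintype F] [Field K] [DecidableEq K]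
    [Algebra F K] [Fintype J] [DecidableEq J] {n α M r δ : ℕ} {k : J → ℕ} {gp : Fin n → J}
    {ω : Fin n → F} {e : (Σ j, Fin (k j)) × Fin α → K}
    (hω : ∀ x y, gp x = gp y → ω x = ω y → x = y) (hδ : 1 ≤ δ) (hk : ∀ j, k j ≤ r)
    (hgp : ∀ j, (Finset.univ.filter (gp · = j)).card = k j + (δ - 1)) :
    HasLocality (Set.range (encode (M := M) gp ω e)) r δ := by
  intro i
  set Γ : Finset (Fin n) := Finset.univ.filter (gp · = gp i) with hΓ
  have hΓc : Γ.card = k (gp i) + (δ - 1) := hgp (gp i)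
  refine ⟨Γ, by simp [hΓ], by have := hk (gp i); omega, ?_⟩
  rintro _ ⟨_, ⟨a, rfl⟩, rfl⟩ _ ⟨_, ⟨a', rfl⟩, rfl⟩ hne
  by_contra hlt
  apply hne
  beta_reduce at hlt
  have hle : (Γ.filter fun x => ¬ encode gp ω e a x = encode gp ω e a' x).card ≤
      hammingDist (fun x : Γ => encode gp ω e a x) (fun x : Γ => encode gp ω e a' x) := by
    refine le_trans (Finset.card_le_card ?_) (Finset.card_image_le (f := Subtype.val))
    intro x hx
    obtain ⟨hxΓ, hx⟩ := Finset.mem_filter.1 hx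
    exact Finset.mem_image.2 ⟨⟨x, hxΓ⟩, by simpa using hx, rfl⟩
  have hadd := Finset.card_filter_add_card_filter_not (s := Γ)
    (fun x => encode gp ω e a x = encode gp ω e a' x)
  funext x
  refine encode_eq_of_eqOn_group hω (j := gp i)
    (B := Γ.filter fun x => encode gp ω e a x = encode gp ω e a' x)
    (fun y hy => by simpa [hΓ] using (Finset.mem_filter.1 hy).1)
    (by omega) (fun y hy => (Finset.mem_filter.1 hy).2) (Finset.mem_filter.1 x.2).2

theorem card_filter_eq_add_hammingDist {ι A : Type*} [Fintype ι] [DecidableEq A]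
    (c c' : ι → A) :
    (Finset.univ.filter fun x => c x = c' x).card + hammingDist c c' = Fintype.card ι :=
  Finset.card_filter_add_card_filter_not (s := Finset.univ) (fun x => c x = c' x)

/-- If each group loses at most `D` of its `s j` coordinates when capped at `k j`, then
`K + a D` coordinates have capped total at least `K`, provided any `a + 1` caps add up to `K`. -/
theorem le_sum_min_of_add_mul_le_sum {J : Type*} [Fintype J] {k s : J → ℕ} {D a K : ℕ}
    (hs : ∀ j, s j ≤ k j + D) (hsum : K + a * D ≤ ∑ j, s j)
    (hbig : ∀ A : Finset J, a + 1 ≤ A.card → K ≤ ∑ j ∈ A, k j) :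
    K ≤ ∑ j, min (s j) (k j) := by
  classical
  set A := Finset.univ.filter fun j => k j < s j with hA
  by_cases hc : a + 1 ≤ A.card
  · calc K ≤ ∑ j ∈ A, k j := hbig A hc
      _ = ∑ j ∈ A, min (s j) (k j) := Finset.sum_congr rfl fun j hj =>
          (min_eq_right (Finset.mem_filter.1 hj).2.le).symm
      _ ≤ ∑ j, min (s j) (k j) := Finset.sum_le_sum_of_subset (Finset.subset_univ _)
  · have hle : ∑ j, s j ≤ ∑ j, (min (s j) (k j) + if k j < s j then D else 0) := by
      refine Finset.sum_le_sum fun j _ => ?_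
      have := hs j
      split_ifs <;> omega
    rw [Finset.sum_add_distrib, ← Finset.sum_filter, Finset.sum_const, smul_eq_mul, ← hA] at hle
    have : A.card * D ≤ a * D := Nat.mul_le_mul_right _ (by omega)
    omega

theorem mul_add_le_sum_elim {G : Type*} {r β a : ℕ} (hβ : β ≤ r) (A : Finset (Option G))
    (hA : a + 1 ≤ A.card) : a * r + β ≤ ∑ j ∈ A, j.elim β fun _ => r := by
  classical
  have hsum : ∑ j ∈ A, ((j.elim β fun _ => r) + if j = none then r - β else 0) =
      A.card * r := by
    rw [← smul_eq_mul, ← Finset.sum_const]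
    refine Finset.sum_congr rfl fun j _ => ?_
    cases j <;> simp [hβ]
  have hone : ∑ j ∈ A, (if j = none then r - β else 0) ≤ r - β := by
    rw [Finset.sum_ite_eq']
    split_ifs <;> omega
  rw [Finset.sum_add_distrib] at hsum
  have : (a + 1) * r ≤ A.card * r := Nat.mul_le_mul_right _ hA
  rw [Nat.add_mul] at this
  omega

/-- Natural numbers `a = ⌈M/(rα)⌉ - 1` and `b` with `⌈M/α⌉ = a r + b` and `0 < b < r`. -/
theorem exists_ceil_div_eq {M α r : ℕ} (hα : 1 ≤ α) (hr : 1 ≤ r)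
    (hmod : 0 < ⌈(M : ℚ) / α⌉ % (r : ℤ)) :
    ∃ a b : ℕ, 0 < b ∧ b < r ∧ ⌈(M : ℚ) / α⌉ = ((a * r + b : ℕ) : ℤ) ∧
      ⌈(M : ℚ) / α⌉ % (r : ℤ) = b ∧ ⌈(M : ℚ) / (r * α)⌉ = a + 1 ∧
      M ≤ (a * r + b) * α ∧ (a * r + (b - 1)) * α < M := by
  have hα' : (0 : ℚ) < α := by exact_mod_cast hα
  have hr' : (0 : ℚ) < r := by exact_mod_cast hr
  obtain ⟨c, hc⟩ : ∃ c : ℕ, ⌈(M : ℚ) / α⌉ = c :=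
    Int.eq_ofNat_of_zero_le (Int.ceil_nonneg (by positivity))
  have hmodc : (⌈(M : ℚ) / α⌉ % (r : ℤ)) = ((c % r : ℕ) : ℤ) := by rw [hc]; norm_cast
  have hb : 0 < c % r := by rw [hmodc] at hmod; exact_mod_cast hmod
  have hdiv : c / r * r + c % r = c := Nat.div_add_mod' c r
  have hblt : c % r < r := Nat.mod_lt _ hr
  obtain ⟨h1, h2⟩ := Int.ceil_eq_iff.1 hc
  rw [lt_div_iff₀ hα'] at h1
  rw [div_le_iff₀ hα'] at h2
  have hle : M ≤ c * α := by exact_mod_cast h2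
  have hlt : (c / r * r + (c % r - 1)) * α < M := by
    have h3 : c / r * r + (c % r - 1) + 1 = c := by omega
    rw [← h3] at h1
    push_cast at h1
    rw [add_sub_cancel_right] at h1
    exact_mod_cast h1
  refine ⟨c / r, c % r, hb, hblt, by rw [hdiv, hc], hmodc, ?_, by rwa [hdiv], hlt⟩
  rw [Int.ceil_eq_iff, lt_div_iff₀ (by positivity), div_le_iff₀ (by positivity)]
  have h4 : c / r * (r * α) < M := by
    refine lt_of_le_of_lt ?_ hlt
    rw [← mul_assoc]
    exact Nat.mul_le_mul_right _ (by omega)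
  have h5 : M ≤ (c / r + 1) * (r * α) := by
    rw [← mul_assoc]
    refine hle.trans (Nat.mul_le_mul_right _ ?_)
    rw [Nat.add_mul]
    omega
  constructor
  · push_cast
    rw [add_sub_cancel_right]
    exact_mod_cast h4
  · exact_mod_cast h5

/-- **Existence of `d_min`-optimal `(r, δ, α)` locally repairable codes, case
`(r + δ - 1) ∤ n`** (Construction I / Theorem 4 of
Rawat–Koyluoglu–Silberstein–Vishwanath).  With `g = ⌊n/(r+δ-1)⌋ + 1`,
`β₀ = n mod (r+δ-1) - (δ-1)` and `N = (g-1) r α + β₀ α`, let `𝓜` satisfy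
`r α ≤ 𝓜 ≤ N` and `0 < ⌈𝓜/α⌉ mod r ≤ β₀`; let `q ≥ r + δ - 1` be a prime power,
`m ≥ N`, and `K` a finite field with `|K| = q^m`.  Then there is a code `C` of length
`n` over `K^α` with `|C| = (q^m)^𝓜`, `(r, δ)` locality, and minimum distance exactly
`n - ⌈𝓜/α⌉ + 1 - (⌈𝓜/(rα)⌉ - 1)(δ - 1)`. -/
theorem lrc_optimal_construction_nondivisible
    (r δ α n q m N g β₀ : ℕ)
    (hr : 1 ≤ r) (hδ : 2 ≤ δ) (hα : 1 ≤ α)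
    (hn : r + δ - 1 < n) (hndvd : ¬ (r + δ - 1) ∣ n)
    (hg : g = n / (r + δ - 1) + 1)
    (hβ₀ : β₀ = n % (r + δ - 1) - (δ - 1))
    (hN : N = (g - 1) * r * α + β₀ * α)
    (M : ℕ) (hM1 : r * α ≤ M) (hM2 : M ≤ N)
    (hMmod : 0 < ⌈(M : ℚ) / α⌉ % (r : ℤ) ∧ ⌈(M : ℚ) / α⌉ % (r : ℤ) ≤ (β₀ : ℤ))
    (hq : IsPrimePow q) (hqrd : r + δ - 1 ≤ q) (hm : N ≤ m)
    (K : Type) [Field K] [Fintype K] [DecidableEq K] (hK : Fintype.card K = q ^ m) :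
    ∃ C : Finset (Fin n → (Fin α → K)),
      C.card = (q ^ m) ^ M ∧
      HasLocality (↑C : Set (Fin n → (Fin α → K))) r δ ∧
      (minDist (↑C : Set (Fin n → (Fin α → K))) : ℤ) =
        (n : ℤ) - ⌈(M : ℚ) / α⌉ + 1 - (⌈(M : ℚ) / (r * α)⌉ - 1) * ((δ : ℤ) - 1) := by
  classical
  obtain ⟨a, b, hb0, hbr, hceil, hmod, hceil', hMle, hMlt⟩ := exists_ceil_div_eq hα hr hMmod.1
  obtain ⟨L, hL⟩ : ∃ L, L = r + δ - 1 := ⟨_, rfl⟩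
  obtain ⟨G, hG⟩ : ∃ G, G = n / L := ⟨_, rfl⟩
  have hbβ : b ≤ β₀ := by
    have := hMmod.2
    rw [hmod] at this
    exact_mod_cast this
  rw [← hL] at hg hβ₀ hqrd
  have hnmod : n % L < L := Nat.mod_lt _ (by omega)
  have hβr : β₀ ≤ r := by omega
  have hnG : n = β₀ + (δ - 1) + G * L := by
    have := Nat.div_add_mod' n L
    rw [← hG] at this
    omega
  have hNG : N = (G * r + β₀) * α := by
    rw [hN, hg, ← hG, Nat.add_sub_cancel, Nat.add_mul]
  have hMpos : 0 < M := lt_of_lt_of_le (Nat.mul_pos hr hα) hM1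
  obtain ⟨F, _, _, _, hFc, hFm⟩ := exists_algebra_card_eq hq (by omega) hK
  set k : Option (Fin G) → ℕ := fun j => j.elim β₀ fun _ => r with hk
  have hkr : ∀ j, k j ≤ r := by
    rintro (_ | j)
    · exact hβr
    · exact le_rfl
  have hksum : ∑ j, k j = G * r + β₀ := by
    simp [hk, Fintype.sum_option, add_comm]
  obtain ⟨e, he⟩ : ∃ e : (Σ j, Fin (k j)) × Fin α → K, LinearIndependent F e := by
    obtain ⟨f, hf⟩ := exists_linearIndependent_of_le_finrank (hm.trans hFm.ge)
    have hcard : Fintype.card ((Σ j, Fin (k j)) × Fin α) = N := by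
      simp [hksum, hNG]
    exact ⟨f ∘ Fintype.equivFinOfCardEq hcard, hf.comp _ (Equiv.injective _)⟩
  obtain ⟨ε⟩ : Nonempty (Fin n ≃ Σ j, Fin (k j + (δ - 1))) := by
    refine Fintype.card_eq.1 ?_
    have hrL : r + (δ - 1) = L := by omega
    simp [hk, Fintype.sum_option, hrL, hnG]
  obtain ⟨emb⟩ : Nonempty (Fin L ↪ F) :=
    Function.Embedding.nonempty_of_card_le (by simpa [hFc] using hqrd)
  let gp : Fin n → Option (Fin G) := fun x => (ε x).1
  let ω : Fin n → F := fun x => emb ⟨(ε x).2, by have := (ε x).2.2; have := hkr (ε x).1; omega⟩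
  have hω : ∀ x y, gp x = gp y → ω x = ω y → x = y := by
    intro x y hgxy hωxy
    have h2 : ((ε x).2 : ℕ) = (ε y).2 := by simpa [ω] using hωxy
    apply ε.injective
    refine Sigma.ext hgxy ?_
    exact (Fin.heq_ext_iff (by rw [show (ε x).1 = (ε y).1 from hgxy])).2 h2
  have hgp : ∀ j, (Finset.univ.filter (gp · = j)).card = k j + (δ - 1) := by
    intro j
    rw [← Fintype.card_fin (k j + (δ - 1)), ← Finset.card_univ]
    refine (Finset.card_bij (fun (i : Fin (k j + (δ - 1))) _ => ε.symm ⟨j, i⟩) ?_ ?_ ?_).symm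
    · intro i _
      simp [gp]
    · intro i _ i' _ h
      simpa using h
    · intro x hx
      obtain rfl := (Finset.mem_filter.1 hx).2
      exact ⟨(ε x).2, Finset.mem_univ _, by simp [gp]⟩
  have hlow : ∀ S : Finset (Fin n), a * r + b + a * (δ - 1) ≤ S.card →
      M ≤ (∑ j, min (S.filter (gp · = j)).card (k j)) * α := by
    intro S hS
    refine hMle.trans (Nat.mul_le_mul_right _ ?_)
    refine le_sum_min_of_add_mul_le_sum (D := δ - 1) (a := a) (fun j => ?_) ?_ fun A hA => ?_
    · rw [← hgp j]
      exact Finset.card_le_card (Finset.filter_subset_filter _ (Finset.subset_univ _))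
    · rwa [← Finset.card_eq_sum_card_fiberwise (f := gp) (t := Finset.univ) (by simp)]
    · exact (Nat.add_le_add_left hbβ _).trans (mul_add_le_sum_elim hβr A hA)
  have hinj : Function.Injective (encode (M := M) gp ω e) := by
    intro c c' h
    refine eq_of_encode_eqOn hω he (S := Finset.univ) ?_ fun x _ => congrFun h x
    refine hM2.trans (hNG.le.trans (Nat.mul_le_mul_right _ ?_))
    rw [← hksum]
    exact Finset.sum_le_sum fun j _ => le_min (by rw [hgp]; omega) le_rfl
  have haG : a ≤ G := by
    by_contra hlt
    have h1 : (G + 1) * r ≤ a * r := Nat.mul_le_mul_right _ (by omega)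
    rw [Nat.add_mul] at h1
    have h2 : N ≤ (a * r + (b - 1)) * α := by
      rw [hNG]
      exact Nat.mul_le_mul_right _ (by omega)
    omega
  have hup : ∃ c c' : Fin M → K, c ≠ c' ∧ a * r + b + a * (δ - 1) ≤
      (Finset.univ.filter fun x => encode gp ω e c x = encode gp ω e c' x).card + 1 := by
    obtain ⟨A', -, hA'⟩ := Finset.exists_subset_card_eq (s := (Finset.univ : Finset (Fin G)))
      (n := a) (by simpa using haG)
    obtain ⟨E, hE, hEc⟩ := Finset.exists_subset_card_eq
      (s := Finset.univ.filter (gp · = none)) (n := b - 1) (by rw [hgp]; simp [hk]; omega)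
    set A : Finset (Option (Fin G)) := A'.map Function.Embedding.some with hA
    obtain ⟨c, c', hne, h⟩ := exists_ne_encode_eqOn (M := M) (e := e) hω
      (fun j => by rw [hgp]; omega) A E (by simpa [hA, hk, hA', hEc] using hMlt)
    refine ⟨c, c', hne, ?_⟩
    have hAc : (Finset.univ.filter (gp · ∈ A)).card = a * r + a * (δ - 1) := by
      rw [Finset.card_eq_sum_card_fiberwise (f := gp) (t := A) (by intro x; simp)]
      have : ∀ j ∈ A, ((Finset.univ.filter (gp · ∈ A)).filter (gp · = j)).card =
          r + (δ - 1) := by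
        intro j hj
        obtain ⟨i, -, rfl⟩ := Finset.mem_map.1 hj
        rw [show r + (δ - 1) = k (some i) + (δ - 1) from rfl, ← hgp, Finset.filter_filter]
        congr 1
        ext x
        simp only [Finset.mem_filter, Finset.mem_univ, true_and]
        exact ⟨fun hx => hx.2, fun hx => ⟨hx ▸ hj, hx⟩⟩
      rw [Finset.sum_congr rfl this, Finset.sum_const, hA, Finset.card_map, hA', smul_eq_mul,
        Nat.mul_add]
    have hdisj : Disjoint (Finset.univ.filter (gp · ∈ A)) E := by
      refine Finset.disjoint_left.2 fun x hx hxE => ?_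
      have h1 := (Finset.mem_filter.1 hx).2
      rw [(Finset.mem_filter.1 (hE hxE)).2] at h1
      simp [hA] at h1
    have hsub : (Finset.univ.filter (gp · ∈ A)) ∪ E ⊆
        Finset.univ.filter fun x => encode gp ω e c x = encode gp ω e c' x := by
      intro x hx
      refine Finset.mem_filter.2 ⟨Finset.mem_univ _, h x ?_⟩
      simpa using hx
    have hcard := Finset.card_le_card hsub
    rw [Finset.card_union_of_disjoint hdisj, hAc, hEc] at hcard
    omega
  refine ⟨Finset.univ.image (encode (M := M) gp ω e), ?_, ?_, ?_⟩
  · rw [Finset.card_image_of_injective _ hinj]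
    simp [hK]
  · rw [Finset.coe_image, Finset.coe_univ, Set.image_univ]
    exact hasLocality_range_encode hω (by omega) hkr hgp
  · rw [Finset.coe_image, Finset.coe_univ, Set.image_univ]
    obtain ⟨c, c', hne, hcc⟩ := hup
    have hmem : hammingDist (encode gp ω e c) (encode gp ω e c') ∈
        {d | ∃ u ∈ Set.range (encode (M := M) gp ω e), ∃ v ∈ Set.range (encode (M := M) gp ω e),
          u ≠ v ∧ hammingDist u v = d} :=
      ⟨_, ⟨c, rfl⟩, _, ⟨c', rfl⟩, hinj.ne hne, rfl⟩
    have hle : minDist (Set.range (encode (M := M) gp ω e)) ≤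
        hammingDist (encode gp ω e c) (encode gp ω e c') := Nat.sInf_le hmem
    have hadd := card_filter_eq_add_hammingDist (encode gp ω e c) (encode gp ω e c')
    obtain ⟨_, ⟨u, rfl⟩, _, ⟨v, rfl⟩, huv, hd⟩ := Nat.sInf_mem ⟨_, hmem⟩
    have hadd' := card_filter_eq_add_hammingDist (encode gp ω e u) (encode gp ω e v)
    change hammingDist _ _ = minDist _ at hd
    have hlt : (Finset.univ.filter fun x => encode gp ω e u x = encode gp ω e v x).card <
        a * r + b + a * (δ - 1) := by
      by_contra hge
      refine huv (congrArg _ (eq_of_encode_eqOn hω he (hlow _ (not_lt.1 hge)) ?_))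
      exact fun x hx => (Finset.mem_filter.1 hx).2
    rw [Fintype.card_fin] at hadd hadd'
    have hfin : minDist (Set.range (encode (M := M) gp ω e)) + (a * r + b) + a * (δ - 1) =
        n + 1 := by
      omega
    rw [hceil, hceil']
    have hfin' := congrArg (Nat.cast : ℕ → ℤ) hfin
    push_cast [Nat.cast_sub (show 1 ≤ δ by omega)] at hfin' ⊢
    linarith
end

section
/- Let F be a field, p ≥ 2 and k ≥ 2 integers, and α a positive integer divisible by p. Suppose that for each j ∈ [k] and each l ∈ [p] there is a matrix S_{l,j} ∈ F^{(α/p)×α}, and for each i ∈ [k] and l ∈ [p] an invertible matrix P_{l,i} ∈ F^{α×α}, such that: (interference alignment) for all i ≠ j in [k] the row spaces of S_{1,j}·P_{1,i}, S_{2,j}·P_{2,i}, …, S_{p,j}·P_{p,i} all coincide and equal a common subspace V_{i,j} ⊆ F^α of dimension α/p; and (exact repair) for every j ∈ [k] the row spaces of S_{1,j}·P_{1,j}, …, S_{p,j}·P_{p,j} together span F^α (equivalently, the stacked α×α matrix [S_{1,j}P_{1,j}; …; S_{p,j}P_{p,j}] has rank α). Then for every i ∈ [k] and every nonempty subset 𝒜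 ⊆ [k] \ {i}, p^{|𝒜|} · dim(⋂_{j∈𝒜} V_{i,j}) ≤ α. -/
/-- The row space of a matrix `M : Matrix (Fin a) (Fin α) F`: the subspace of `F^α`
spanned by the rows of `M` (the range of `x ↦ x ᵥ* M`). -/
def rowSpace {F : Type*} [Field F] {a α : ℕ} (M : Matrix (Fin a) (Fin α) F) :
    Submodule F (Fin α → F) :=
  LinearMap.range M.vecMulLinear

/-- If finitely many subspaces span a finite-dimensional space and their dimensions add up to at
most its dimension, then any subspaces of them lying in a common `B` have dimensions adding up to at
most `dim B`. -/
theorem sum_finrank_le_of_iSup_eq_top {F E ι : Type*} [Field F] [AddCommGroup E] [Module F E]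
    [FiniteDimensional F E] [Fintype ι] [DecidableEq ι] (T U : ι → Submodule F E)
    (B : Submodule F E) (hT : ⨆ l, T l = ⊤)
    (hdim : ∑ l, Module.finrank F (T l) ≤ Module.finrank F E)
    (hUT : ∀ l, U l ≤ T l) (hUB : ∀ l, U l ≤ B) :
    ∑ l, Module.finrank F (U l) ≤ Module.finrank F B := by
  let g : (∀ l, T l) →ₗ[F] E := LinearMap.lsum F (fun l => T l) F fun l => (T l).subtype
  have hg (x : ∀ l, T l) : g x = ∑ l, (x l : E) := by simp [g]
  have hsurj : Function.Surjective g := by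
    rw [← LinearMap.range_eq_top, eq_top_iff, ← hT, iSup_le_iff]
    intro l x hx
    exact ⟨Pi.single l ⟨x, hx⟩, by simp only [g, LinearMap.lsum_piSingle, Submodule.subtype_apply]⟩
  have hinj : Function.Injective g := by
    refine (LinearMap.injective_iff_surjective_of_finrank_eq_finrank ?_).2 hsurj
    refine le_antisymm ?_ (LinearMap.finrank_le_finrank_of_surjective hsurj)
    rwa [Module.finrank_pi_fintype]
  let f : (∀ l, U l) →ₗ[F] B :=
    LinearMap.lsum F (fun l => U l) F fun l => Submodule.inclusion (hUB l)
  have hf (x : ∀ l, U l) : (f x : E) = ∑ l, (x l : E) := by simp [f]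
  have hfinj : Function.Injective f := by
    intro x y hxy
    have h := congrArg (Subtype.val) hxy
    rw [hf, hf] at h
    have h' := @hinj (fun l => ⟨x l, hUT l (x l).2⟩) (fun l => ⟨y l, hUT l (y l).2⟩)
      (by simpa only [hg] using h)
    funext l
    exact Subtype.ext (Subtype.mk.inj (congrFun h' l))
  simpa [Module.finrank_pi_fintype] using LinearMap.finrank_le_finrank_of_injective hfinj

theorem rowSpace_mul {F : Type*} [Field F] {a m n : ℕ} (M : Matrix (Fin a) (Fin m) F)
    (N : Matrix (Fin m) (Fin n) F) :
    rowSpace (M * N) = (rowSpace M).map N.vecMulLinear := by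
  unfold rowSpace
  rw [← LinearMap.range_comp]
  exact congrArg LinearMap.range (LinearMap.ext fun x => (Matrix.vecMul_vecMul x M N).symm)

theorem finrank_rowSpace_le {F : Type*} [Field F] {a n : ℕ} (M : Matrix (Fin a) (Fin n) F) :
    Module.finrank F (rowSpace M) ≤ a :=
  (LinearMap.finrank_range_le M.vecMulLinear).trans (by simp)

/-- **Intersection bound on repair subspaces of exact-repairable linear MSR codes with
interference alignment** (Lemma 4 of Rawat–Koyluoglu–Silberstein–Vishwanath).  Here
`p = n - k ≥ 2` is the number of parities, `α = p * a` the (sub-packetized) node size,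
`S l j` the `(α/p) × α` repair matrices and `P l i` invertible `α × α` matrices such
that for `i ≠ j` the row spaces of `S l j * P l i` all equal a common subspace `V i j`
of dimension `α/p` (interference alignment), while for each `j` the row spaces of
`S l j * P l j`, `l = 1, …, p`, together span `F^α` (exact repair).  Then for every `i`
and every nonempty `𝒜 ⊆ [k] \ {i}` one has
`p^|𝒜| · dim(⋂_{j ∈ 𝒜} V i j) ≤ α`. -/
theorem msr_repair_subspace_intersection_bound
    {F : Type} [Field F]
    (p k a α : ℕ) (hp : 2 ≤ p) (hk : 2 ≤ k) (hα : 0 < α) (ha : α = p * a)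
    (S : Fin p → Fin k → Matrix (Fin a) (Fin α) F)
    (P : Fin p → Fin k → Matrix (Fin α) (Fin α) F)
    (hP : ∀ l i, IsUnit (P l i))
    (V : Fin k → Fin k → Submodule F (Fin α → F))
    (hIA : ∀ i j, i ≠ j →
      (∀ l, rowSpace (S l j * P l i) = V i j) ∧ Module.finrank F ↥(V i j) = a)
    (hER : ∀ j, (⨆ l, rowSpace (S l j * P l j)) = ⊤) :
    ∀ i : Fin k, ∀ 𝒜 : Finset (Fin k), 𝒜.Nonempty → i ∉ 𝒜 →
      p ^ 𝒜.card * Module.finrank F ↥(⨅ j ∈ 𝒜, V i j) ≤ α := by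
  intro i 𝒜 h𝒜
  clear h𝒜
  induction 𝒜 using Finset.induction_on generalizing i with
  | empty => simpa using Submodule.finrank_le (⨅ j ∈ (∅ : Finset (Fin k)), V i j)
  | insert j ℬ hj ih =>
    intro hi
    obtain ⟨hij, hiℬ⟩ : i ≠ j ∧ i ∉ ℬ := by simpa using hi
    rw [Finset.iInf_insert, Finset.card_insert_of_notMem hj, pow_succ, mul_assoc]
    refine le_trans (Nat.mul_le_mul_left _ ?_) (ih j hj)
    let Q : Fin p → Matrix (Fin α) (Fin α) F := fun l => (P l i)⁻¹ * P l j
    have hQ (l) : Function.Injective (Q l).vecMulLinear :=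
      Matrix.vecMul_injective_of_isUnit
        ((Matrix.isUnit_nonsing_inv_iff.2 (hP l i)).mul (hP l j))
    have hV (l b) (hb : i ≠ b) : (V i b).map (Q l).vecMulLinear = rowSpace (S l b * P l j) := by
      rw [← (hIA i b hb).1 l, ← rowSpace_mul]
      have : P l i * (P l i)⁻¹ = 1 :=
        Matrix.mul_nonsing_inv _ ((Matrix.isUnit_iff_isUnit_det _).1 (hP l i))
      simp only [Q]
      rw [Matrix.mul_assoc (S l b), ← Matrix.mul_assoc (P l i), this, Matrix.one_mul]
    have key := sum_finrank_le_of_iSup_eq_top (fun l => rowSpace (S l j * P l j))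
      (fun l => (V i j ⊓ ⨅ b ∈ ℬ, V i b).map (Q l).vecMulLinear) (⨅ b ∈ ℬ, V j b) (hER j)
      ?_ ?_ ?_
    · have hfin (l) := (Submodule.equivMapOfInjective _ (hQ l)
        (V i j ⊓ ⨅ b ∈ ℬ, V i b)).finrank_eq
      simpa [← hfin] using key
    · refine (Finset.sum_le_sum fun l _ => finrank_rowSpace_le _).trans ?_
      simp [ha]
    · intro l
      rw [← hV l j hij]
      exact Submodule.map_mono inf_le_left
    · intro l
      refine le_iInf₂ fun b hb => ?_
      have hib : i ≠ b := fun h => hiℬ (h ▸ hb)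
      have hjb : j ≠ b := fun h => hj (h ▸ hb)
      rw [← (hIA j b hjb).1 l, ← hV l b hib]
      exact Submodule.map_mono (inf_le_right.trans (iInf₂_le b hb))
end
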